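/- Let G act on the left on sets E and M, let φ : E → M be G-equivariant, let Hor ⊆ M × M be a discrete connection on the G-set M with form Ad and horizontal lift hd, and let Υ : E × M → G̃_E × (M/G) be the induced map. Then Υ is surjective, and its fibers are exactly the orbits of the diagonal G-action on E × M: Υ(ε', m') = Υ(ε, m) if and only if there exists g ∈ G with ε' = g • ε and m' = g • m. -/

import Mathlib

/-- A discrete connection on the `G`-set `M`. -/
structure DiscreteConnection (G M : Type*) [Group G] [MulAction G M] where
  Hor : Set (M × M)
  invariant : ∀ (g : G) (m₀ m₁ : M), (m₀, m₁) ∈ Hor → (g • m₀, g • m₁) ∈ Hor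
  Ad : M × M → G
  mem_hor_Ad : ∀ m₀ m₁ : M, (m₀, (Ad (m₀, m₁))⁻¹ • m₁) ∈ Hor
  Ad_unique : ∀ (m₀ m₁ : M) (g : G), (m₀, g⁻¹ • m₁) ∈ Hor → g = Ad (m₀, m₁)
  hd : M → Quotient (MulAction.orbitRel G M) → M
  mem_hor_hd : ∀ (m₀ : M) (r : Quotient (MulAction.orbitRel G M)), (m₀, hd m₀ r) ∈ Hor
  orbit_hd : ∀ (m₀ : M) (r : Quotient (MulAction.orbitRel G M)),
    Quotient.mk (MulAction.orbitRel G M) (hd m₀ r) = r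
  hd_unique : ∀ (m₀ m₁ : M) (r : Quotient (MulAction.orbitRel G M)),
    (m₀, m₁) ∈ Hor → Quotient.mk (MulAction.orbitRel G M) m₁ = r → m₁ = hd m₀ r

/-- The total space of the conjugate bundle: pairs `(ε, w) ∈ E × G` with the
`G`-action `g • (ε, w) = (g • ε, g w g⁻¹)`. -/
structure ConjPair (E G : Type*) where
  base : E
  grp : G

instance ConjPair.instSMul {G E : Type*} [Group G] [MulAction G E] : SMul G (ConjPair E G) :=
  ⟨fun g p => ⟨g • p.base, g * p.grp * g⁻¹⟩⟩

theorem ConjPair.smul_def {G E : Type*} [Group G] [MulAction G E] (g : G) (p : ConjPair E G) :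
    g • p = ⟨g • p.base, g * p.grp * g⁻¹⟩ := rfl

instance ConjPair.instMulAction {G E : Type*} [Group G] [MulAction G E] :
    MulAction G (ConjPair E G) where
  one_smul p := by simp [ConjPair.smul_def]
  mul_smul g h p := by simp [ConjPair.smul_def, mul_smul, mul_assoc]

/-- The map `Υ : E × M → G̃_E × (M/G)` induced by a discrete connection. -/
def Upsilon {G E M : Type*} [Group G] [MulAction G E] [MulAction G M]
    (φ : E → M) (D : DiscreteConnection G M) :
    E × M →
      Quotient (MulAction.orbitRel G (ConjPair E G)) × Quotient (MulAction.orbitRel G M) :=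
  fun p =>
    (Quotient.mk (MulAction.orbitRel G (ConjPair E G)) ⟨p.1, D.Ad (φ p.1, p.2)⟩,
     Quotient.mk (MulAction.orbitRel G M) p.2)


namespace DiscreteConnection

variable {G M : Type*} [Group G] [MulAction G M] (D : DiscreteConnection G M)

theorem Ad_smul_smul (g : G) (m₀ m₁ : M) :
    D.Ad (g • m₀, g • m₁) = g * D.Ad (m₀, m₁) * g⁻¹ := by
  refine (D.Ad_unique _ _ _ ?_).symm
  simpa [mul_smul] using D.invariant g _ _ (D.mem_hor_Ad m₀ m₁)

theorem Ad_smul_hd (w : G) (m₀ : M) (r : Quotient (MulAction.orbitRel G M)) :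
    D.Ad (m₀, w • D.hd m₀ r) = w := by
  refine (D.Ad_unique _ _ _ ?_).symm
  simpa using D.mem_hor_hd m₀ r

theorem mk_smul (g : G) (m : M) :
    Quotient.mk (MulAction.orbitRel G M) (g • m) = Quotient.mk (MulAction.orbitRel G M) m :=
  Quotient.sound (MulAction.mem_orbit m g)

/-- A point is recovered from its discrete connection form and its orbit. -/
theorem Ad_smul_hd_mk (m₀ m₁ : M) :
    D.Ad (m₀, m₁) • D.hd m₀ (Quotient.mk (MulAction.orbitRel G M) m₁) = m₁ := by
  rw [← D.hd_unique _ _ _ (D.mem_hor_Ad m₀ m₁) (mk_smul _ m₁), smul_inv_smul]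

end DiscreteConnection

/-- `Υ : E × M → G̃_E × (M/G)` is surjective and its fibers are exactly the orbits of the
diagonal `G`-action on `E × M`. -/
theorem upsilon_surjective_fibers_orbits {G E M : Type*} [Group G] [MulAction G E]
    [MulAction G M] (φ : E → M) (hφ : ∀ (g : G) (ε : E), φ (g • ε) = g • φ ε)
    (D : DiscreteConnection G M) :
    Function.Surjective (Upsilon φ D) ∧
    ∀ (ε ε' : E) (m m' : M),
      Upsilon φ D (ε', m') = Upsilon φ D (ε, m) ↔ ∃ g : G, ε' = g • ε ∧ m' = g • m := by
  refine ⟨?_, fun ε ε' m m' => ⟨fun h => ?_, ?_⟩⟩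
  · rintro ⟨q, r⟩
    induction q using Quotient.inductionOn with | h p => ?_
    refine ⟨(p.base, p.grp • D.hd (φ p.base) r), Prod.ext ?_ ?_⟩
    · simp only [Upsilon, D.Ad_smul_hd]
    · exact (DiscreteConnection.mk_smul _ _).trans (D.orbit_hd _ _)
  · obtain ⟨hpair, horbit⟩ := Prod.ext_iff.mp h
    obtain ⟨g, hg⟩ := Quotient.exact hpair
    obtain ⟨hbase, hAd⟩ := ConjPair.mk.inj hg
    dsimp only at hbase hAd horbit
    subst hbase
    refine ⟨g, rfl, ?_⟩
    have horbit' : Quotient.mk (MulAction.orbitRel G M) m' =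
        Quotient.mk (MulAction.orbitRel G M) (g • m) :=
      horbit.trans (DiscreteConnection.mk_smul g m).symm
    rw [← D.Ad_smul_hd_mk (φ (g • ε)) m', ← D.Ad_smul_hd_mk (φ (g • ε)) (g • m), ← hAd,
      horbit', hφ, D.Ad_smul_smul]
  · rintro ⟨g, rfl, rfl⟩
    refine Prod.ext (Quotient.sound ⟨g, ?_⟩) (DiscreteConnection.mk_smul g m)
    simp [ConjPair.smul_def, hφ, D.Ad_smul_smul]
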